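/- Let a_k = ∏_p ( (1 - 1/p)^{k²} ∑_{r=0}^∞ d_k(p^r)² p^{-r} ), the product being over all primes p. Then, as the integer k → ∞, log a_k = -k² log(2 e^γ log k) + o(k²); equivalently, lim_{k→∞} [ (log a_k)/k² + log(2 e^γ log k) ] = 0, where γ is the Euler–Mascheroni constant. -/

import Mathlib

open Filter Topology

/-- The `k`-th divisor function `d_k`, the `k`-fold Dirichlet convolution of the
constant function `1`. -/
noncomputable def dk (k : ℕ) : ArithmeticFunction ℕ := ArithmeticFunction.zeta ^ k

/-- The arithmetic factor `a_k = ∏_p (1 - 1/p)^{k²} ∑_{r=0}^∞ d_k(p^r)² p^{-r}`. -/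
noncomputable def aCG (k : ℕ) : ℝ :=
  ∏' p : Nat.Primes, ((1 - 1 / (p : ℝ)) ^ (k ^ 2) *
    ∑' r : ℕ, (dk k ((p : ℕ) ^ r) : ℝ) ^ 2 / (p : ℝ) ^ r)

/-- Nonnegative weights `a i` at positive points `t i` whose Laplace transform at `δ` is
`-log δ + o(1)` as `δ → 0⁺`. -/
structure IsLogarithmic {ι : Type} (a t : ι → ℝ) : Prop where
  nonneg : ∀ i, 0 ≤ a i
  pos : ∀ i, 0 < t i
  summable : ∀ δ : ℝ, 0 < δ → Summable fun i => a i * Real.exp (-(δ * t i))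
  tendsto : Tendsto (fun δ : ℝ => ∑' i, a i * Real.exp (-(δ * t i)) + Real.log δ) (𝓝[>] 0) (𝓝 0)

/-- The limit functional on polynomials in Karamata's method. -/
noncomputable def karamataLimit (q : Polynomial ℝ) : ℝ :=
  q.sum fun m c => c * Real.log ((m + 2) / (m + 1))

lemma karamataLimit_add (p q : Polynomial ℝ) :
    karamataLimit (p + q) = karamataLimit p + karamataLimit q :=
  Polynomial.sum_add_index _ _ _ (by simp) (by intros; ring)

lemma karamataLimit_monomial (m : ℕ) (c : ℝ) :
    karamataLimit (Polynomial.monomial m c) = c * Real.log ((m + 2) / (m + 1)) :=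
  Polynomial.sum_monomial_index _ _ (by simp)

lemma karamataLimit_eq_integral (q : Polynomial ℝ) :
    karamataLimit q = ∫ x in (0 : ℝ)..1, ∫ u in (0 : ℝ)..1, q.eval u * u ^ x := by
  have inner : ∀ x ∈ Set.uIcc (0 : ℝ) 1, ∫ u in (0 : ℝ)..1, q.eval u * u ^ x =
      ∑ m ∈ q.support, q.coeff m * (1 / (m + 1 + x)) := by
    intro x hx
    rw [Set.uIcc_of_le zero_le_one] at hx
    have hx0 := hx.1
    have h1 : ∀ u ∈ Set.uIcc (0 : ℝ) 1, q.eval u * u ^ x =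
        ∑ m ∈ q.support, q.coeff m * u ^ ((m : ℝ) + x) := by
      intro u hu
      rw [Set.uIcc_of_le zero_le_one] at hu
      rw [Polynomial.eval_eq_sum, Polynomial.sum, Finset.sum_mul]
      refine Finset.sum_congr rfl fun m _ => ?_
      rw [mul_assoc, Real.rpow_add_of_nonneg hu.1 (by positivity) hx0, Real.rpow_natCast]
    rw [intervalIntegral.integral_congr h1, intervalIntegral.integral_finsetSum]
    · refine Finset.sum_congr rfl fun m _ => ?_
      have hm : (0 : ℝ) ≤ m := m.cast_nonneg
      rw [intervalIntegral.integral_const_mul, integral_rpow (Or.inl (by linarith)),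
        Real.one_rpow, Real.zero_rpow (by positivity)]
      ring_nf
    · intro m _
      have hm : (0 : ℝ) ≤ m := m.cast_nonneg
      exact (intervalIntegral.intervalIntegrable_rpow' (by linarith)).const_mul _
  rw [intervalIntegral.integral_congr inner, intervalIntegral.integral_finsetSum]
  · rw [karamataLimit, Polynomial.sum]
    refine Finset.sum_congr rfl fun m _ => ?_
    have hm : (0 : ℝ) ≤ m := m.cast_nonneg
    rw [intervalIntegral.integral_const_mul,
      intervalIntegral.integral_comp_add_left (fun y => 1 / y) ((m : ℝ) + 1),
      integral_one_div_of_pos (by positivity) (by positivity)]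
    ring_nf
  · intro m _
    refine ContinuousOn.intervalIntegrable ?_
    refine continuousOn_const.mul (continuousOn_const.div (by fun_prop) ?_)
    intro x hx
    rw [Set.uIcc_of_le zero_le_one] at hx
    have := hx.1
    positivity

lemma karamataLimit_le_integral {q : Polynomial ℝ} (hq : ∀ u ∈ Set.Icc (0 : ℝ) 1, 0 ≤ q.eval u) :
    karamataLimit q ≤ ∫ u in (0 : ℝ)..1, q.eval u := by
  rw [karamataLimit_eq_integral]
  have hB : ∀ x ∈ Set.Icc (0 : ℝ) 1,
      ∫ u in (0 : ℝ)..1, q.eval u * u ^ x ≤ ∫ u in (0 : ℝ)..1, q.eval u := by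
    intro x hx
    refine intervalIntegral.integral_mono_on zero_le_one ?_ ?_ ?_
    · exact (q.continuous.mul (Real.continuous_rpow_const hx.1)).intervalIntegrable _ _
    · exact q.continuous.intervalIntegrable _ _
    · intro u hu
      exact mul_le_of_le_one_right (hq u hu) (Real.rpow_le_one hu.1 hu.2 hx.1)
  have h0 : 0 ≤ ∫ u in (0 : ℝ)..1, q.eval u :=
    intervalIntegral.integral_nonneg zero_le_one hq
  by_cases hi : IntervalIntegrable (fun x : ℝ => ∫ u in (0 : ℝ)..1, q.eval u * u ^ x)
      MeasureTheory.volume 0 1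
  · calc _ ≤ ∫ _x in (0 : ℝ)..1, ∫ u in (0 : ℝ)..1, q.eval u :=
        intervalIntegral.integral_mono_on zero_le_one hi (by simp) hB
      _ = _ := by simp
  · rw [intervalIntegral.integral_undef hi]
    exact h0

section Karamata

variable {ι : Type} {a t : ι → ℝ}

lemma IsLogarithmic.summable_poly (h : IsLogarithmic a t) (q : Polynomial ℝ) {δ : ℝ} (hδ : 0 < δ) :
    Summable fun i => a i * ((1 - Real.exp (-(δ * t i))) * Real.exp (-(δ * t i)) *
      q.eval (Real.exp (-(δ * t i)))) := by
  induction q using Polynomial.induction_on' with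
  | add p q hp hq =>
    refine (hp.add hq).congr fun i => ?_
    rw [Polynomial.eval_add]; ring
  | monomial m c =>
    have h1 := h.summable ((m + 1) * δ) (by positivity)
    have h2 := h.summable ((m + 2) * δ) (by positivity)
    refine ((h1.sub h2).mul_left c).congr fun i => ?_
    rw [Polynomial.eval_monomial]
    have e1 : Real.exp (-((m + 1) * δ * t i)) = Real.exp (-(δ * t i)) ^ (m + 1) := by
      rw [← Real.exp_nat_mul]; push_cast; ring_nf
    have e2 : Real.exp (-((m + 2) * δ * t i)) = Real.exp (-(δ * t i)) ^ (m + 2) := by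
      rw [← Real.exp_nat_mul]; push_cast; ring_nf
    rw [e1, e2]; ring

lemma IsLogarithmic.tendsto_poly (h : IsLogarithmic a t) (q : Polynomial ℝ) :
    Tendsto (fun δ : ℝ => ∑' i, a i * ((1 - Real.exp (-(δ * t i))) * Real.exp (-(δ * t i)) *
      q.eval (Real.exp (-(δ * t i))))) (𝓝[>] 0) (𝓝 (karamataLimit q)) := by
  induction q using Polynomial.induction_on' with
  | add p q hp hq =>
    rw [karamataLimit_add]
    refine (hp.add hq).congr' ?_
    filter_upwards [self_mem_nhdsWithin] with δ hδ
    rw [← (h.summable_poly p hδ).tsum_add (h.summable_poly q hδ)]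
    refine tsum_congr fun i => ?_
    rw [Polynomial.eval_add]; ring
  | monomial m c =>
    rw [karamataLimit_monomial]
    have scale : ∀ s : ℝ, 0 < s → Tendsto (fun δ : ℝ => s * δ) (𝓝[>] 0) (𝓝[>] 0) := by
      intro s hs
      refine tendsto_nhdsWithin_iff.2 ⟨?_, ?_⟩
      · have : Tendsto (fun δ : ℝ => s * δ) (𝓝 0) (𝓝 (s * 0)) := tendsto_id.const_mul s
        rw [mul_zero] at this
        exact this.mono_left nhdsWithin_le_nhds
      · filter_upwards [self_mem_nhdsWithin] with δ hδ
        exact mul_pos hs hδ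
    have h1 := h.tendsto.comp (scale (m + 1) (by positivity))
    have h2 := h.tendsto.comp (scale (m + 2) (by positivity))
    have h3 := ((h1.sub h2).const_add (Real.log ((m + 2) / (m + 1)))).const_mul c
    rw [sub_zero, add_zero] at h3
    refine h3.congr' ?_
    filter_upwards [self_mem_nhdsWithin] with δ (hδ : 0 < δ)
    simp only [Function.comp_apply]
    have s1 := h.summable ((m + 1) * δ) (by positivity)
    have s2 := h.summable ((m + 2) * δ) (by positivity)
    have key : ∑' i, a i * ((1 - Real.exp (-(δ * t i))) * Real.exp (-(δ * t i)) *
        (Polynomial.monomial m c).eval (Real.exp (-(δ * t i)))) =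
        c * (∑' i, a i * Real.exp (-((m + 1) * δ * t i)) -
          ∑' i, a i * Real.exp (-((m + 2) * δ * t i))) := by
      rw [← s1.tsum_sub s2, ← tsum_mul_left]
      refine tsum_congr fun i => ?_
      rw [Polynomial.eval_monomial]
      have e1 : Real.exp (-((m + 1) * δ * t i)) = Real.exp (-(δ * t i)) ^ (m + 1) := by
        rw [← Real.exp_nat_mul]; push_cast; ring_nf
      have e2 : Real.exp (-((m + 2) * δ * t i)) = Real.exp (-(δ * t i)) ^ (m + 2) := by
        rw [← Real.exp_nat_mul]; push_cast; ring_nf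
      rw [e1, e2]; ring
    rw [key, Real.log_mul (by positivity) hδ.ne', Real.log_mul (by positivity) hδ.ne',
      Real.log_div (by positivity) (by positivity)]
    ring

end Karamata

/-- Continuous minorants and majorants of a step function with values between `-1 / (1 - u)` and
`1 / u`, arbitrarily close to each other in mean. -/
lemma exists_continuous_sandwich {b : ℝ} (hb : 0 < b) (hb1 : b < 1) {ε : ℝ} (hε : 0 < ε) :
    ∃ f g : ℝ → ℝ, Continuous f ∧ Continuous g ∧ (∀ u, f u ≤ g u) ∧
      (∀ u, 0 < u → u < 1 → (1 - u) * u * f u ≤ (if b ≤ u then 1 else 0) - u ∧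
        (if b ≤ u then 1 else 0) - u ≤ (1 - u) * u * g u) ∧
      ∫ u in (0 : ℝ)..1, (g u - f u) ≤ ε := by
  set K : ℝ := 1 / b + 1 / (1 - b) with hK
  have hb2 : 0 < 1 - b := by linarith
  have hK0 : 0 < K := by positivity
  set η : ℝ := min (min b (1 - b)) (ε / (2 * K)) with hη
  have hη0 : 0 < η := by positivity
  have hηb : η ≤ b := (min_le_left _ _).trans (min_le_left _ _)
  have hηb1 : η ≤ 1 - b := (min_le_left _ _).trans (min_le_right _ _)
  have hηε : η ≤ ε / (2 * K) := min_le_right _ _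
  set A : ℝ → ℝ := fun u => -(1 / (1 - min u b)) with hA
  set B : ℝ → ℝ := fun u => 1 / max u b with hB
  set φ : ℝ → ℝ := fun u => max 0 (min 1 (1 + (u - b) / η)) with hφ
  set ψ : ℝ → ℝ := fun u => max 0 (min 1 ((u - b) / η)) with hψ
  have cA : Continuous A := by
    refine (Continuous.div (by fun_prop) (by fun_prop) fun u => ?_).neg
    have := min_le_right u b
    exact ne_of_gt (by linarith)
  have cB : Continuous B := by
    refine Continuous.div (by fun_prop) (by fun_prop) fun u => ?_
    have := le_max_right u b
    exact ne_of_gt (by linarith)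
  have cφ : Continuous φ := by fun_prop
  have cψ : Continuous ψ := by fun_prop
  have hBA0 : ∀ u, 0 ≤ B u - A u := by
    intro u
    have h1 := min_le_right u b
    have h2 := le_max_right u b
    have h3 : 0 ≤ 1 / (1 - min u b) := one_div_nonneg.2 (by linarith)
    have h4 : 0 ≤ 1 / max u b := one_div_nonneg.2 (by linarith)
    simp only [hA, hB]; linarith
  have hBAK : ∀ u, B u - A u ≤ K := by
    intro u
    have h1 := min_le_right u b
    have h2 := le_max_right u b
    have h3 : 1 / (1 - min u b) ≤ 1 / (1 - b) := one_div_le_one_div_of_le hb2 (by linarith)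
    have h4 : 1 / max u b ≤ 1 / b := one_div_le_one_div_of_le hb h2
    simp only [hA, hB]; linarith
  have hψ0 : ∀ u, 0 ≤ ψ u := fun u => le_max_left _ _
  have hφ1 : ∀ u, φ u ≤ 1 := fun u => max_le zero_le_one (min_le_left _ _)
  have hφ0 : ∀ u, 0 ≤ φ u := fun u => le_max_left _ _
  have hψ1 : ∀ u, ψ u ≤ 1 := fun u => max_le zero_le_one (min_le_left _ _)
  have hψφ : ∀ u, ψ u ≤ φ u := fun u =>
    max_le_max le_rfl (min_le_min le_rfl (by linarith))
  have hψb : ∀ u, u ≤ b → ψ u = 0 := by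
    intro u hu
    have : (u - b) / η ≤ 0 := div_nonpos_of_nonpos_of_nonneg (by linarith) hη0.le
    exact max_eq_left ((min_le_right _ _).trans this)
  have hφb : ∀ u, b ≤ u → φ u = 1 := by
    intro u hu
    have : 0 ≤ (u - b) / η := div_nonneg (by linarith) hη0.le
    simp only [hφ]
    rw [min_eq_left (by linarith), max_eq_right zero_le_one]
  have hφl : ∀ u, u ≤ b - η → φ u = 0 := by
    intro u hu
    have : (u - b) / η ≤ -1 := by rw [div_le_iff₀ hη0]; linarith
    exact max_eq_left ((min_le_right _ _).trans (by linarith))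
  have hψr : ∀ u, b + η ≤ u → ψ u = 1 := by
    intro u hu
    have : 1 ≤ (u - b) / η := by rw [le_div_iff₀ hη0]; linarith
    simp only [hψ]
    rw [min_eq_left (by linarith), max_eq_right zero_le_one]
  refine ⟨fun u => A u + (B u - A u) * ψ u, fun u => A u + (B u - A u) * φ u, by fun_prop,
    by fun_prop, fun u => ?_, fun u hu0 hu1 => ?_, ?_⟩
  · have := mul_le_mul_of_nonneg_left (hψφ u) (hBA0 u)
    simpa using this
  · have hp : 0 < (1 - u) * u := mul_pos (by linarith) hu0
    have l1 : A u ≤ A u + (B u - A u) * φ u := by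
      have := mul_nonneg (hBA0 u) (hφ0 u); linarith
    have l2 : A u + (B u - A u) * ψ u ≤ B u := by
      have := mul_le_mul_of_nonneg_left (hψ1 u) (hBA0 u); linarith
    by_cases h : b ≤ u
    · have e : (1 - u) * u * B u = 1 - u := by
        simp only [hB]; rw [max_eq_left h]; field_simp
      simp only [h, if_true]
      rw [hφb u h]
      constructor
      · exact (mul_le_mul_of_nonneg_left l2 hp.le).trans e.le
      · rw [mul_one, add_sub_cancel]; exact e.ge
    · have hu : u ≤ b := (not_le.1 h).le
      have hu' : 1 - u ≠ 0 := by linarith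
      have e : (1 - u) * u * A u = -u := by
        simp only [hA]; rw [min_eq_left hu]; field_simp
      simp only [h, if_false]
      rw [hψb u hu]
      constructor
      · rw [mul_zero, add_zero, e]; linarith
      · rw [zero_sub, ← e]
        exact mul_le_mul_of_nonneg_left l1 hp.le
  · have e : (fun u => A u + (B u - A u) * φ u - (A u + (B u - A u) * ψ u)) =
        fun u => (B u - A u) * (φ u - ψ u) := by funext u; ring
    simp only [e]
    set w : ℝ → ℝ := fun u => (B u - A u) * (φ u - ψ u) with hw
    have cw : Continuous w := by fun_prop
    have hi : ∀ x y : ℝ, IntervalIntegrable w MeasureTheory.volume x y :=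
      fun x y => cw.intervalIntegrable x y
    rw [← intervalIntegral.integral_add_adjacent_intervals (hi 0 (b - η)) (hi (b - η) 1),
      ← intervalIntegral.integral_add_adjacent_intervals (hi (b - η) (b + η)) (hi (b + η) 1)]
    have z1 : ∫ u in (0 : ℝ)..(b - η), w u = 0 := by
      refine intervalIntegral.integral_zero_ae (Filter.Eventually.of_forall fun u hu => ?_)
      rw [Set.uIoc_of_le (by linarith)] at hu
      simp only [hw]
      rw [hφl u hu.2, hψb u (by linarith [hu.2])]; simp
    have z2 : ∫ u in (b + η)..1, w u = 0 := by
      refine intervalIntegral.integral_zero_ae (Filter.Eventually.of_forall fun u hu => ?_)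
      rw [Set.uIoc_of_le (by linarith)] at hu
      simp only [hw]
      rw [hψr u hu.1.le, hφb u (by linarith [hu.1])]; simp
    have z3 : ∫ u in (b - η)..(b + η), w u ≤ ∫ _u in (b - η)..(b + η), K := by
      refine intervalIntegral.integral_mono_on (by linarith) (hi _ _) (by simp) fun u _ => ?_
      have h1 := hψ0 u
      have h2 := hφ1 u
      have h3 := hψφ u
      calc w u ≤ (B u - A u) * 1 := mul_le_mul_of_nonneg_left (by linarith) (hBA0 u)
        _ ≤ K := by rw [mul_one]; exact hBAK u
    rw [intervalIntegral.integral_const, smul_eq_mul] at z3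
    rw [le_div_iff₀ (by positivity)] at hηε
    rw [z1, z2]
    linarith

lemma exists_polynomial_sandwich {b : ℝ} (hb : 0 < b) (hb1 : b < 1) {ε : ℝ} (hε : 0 < ε) :
    ∃ p q : Polynomial ℝ, (∀ u ∈ Set.Icc (0 : ℝ) 1, 0 ≤ (q - p).eval u) ∧
      (∀ u, 0 < u → u < 1 → (1 - u) * u * p.eval u ≤ (if b ≤ u then 1 else 0) - u ∧
        (if b ≤ u then 1 else 0) - u ≤ (1 - u) * u * q.eval u) ∧
      ∫ u in (0 : ℝ)..1, (q - p).eval u ≤ ε := by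
  obtain ⟨f, g, cf, cg, hfg, hs, hint⟩ := exists_continuous_sandwich hb hb1 (half_pos hε)
  have hε8 : 0 < ε / 8 := by positivity
  obtain ⟨p, hp⟩ := exists_polynomial_near_of_continuousOn 0 1 (fun u => f u - ε / 8)
    (by fun_prop) _ hε8
  obtain ⟨q, hq⟩ := exists_polynomial_near_of_continuousOn 0 1 (fun u => g u + ε / 8)
    (by fun_prop) _ hε8
  have hpf : ∀ u ∈ Set.Icc (0 : ℝ) 1, p.eval u ≤ f u ∧ f u - ε / 4 ≤ p.eval u := by
    intro u hu
    have := abs_lt.1 (hp u hu)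
    constructor <;> linarith
  have hgq : ∀ u ∈ Set.Icc (0 : ℝ) 1, g u ≤ q.eval u ∧ q.eval u ≤ g u + ε / 4 := by
    intro u hu
    have := abs_lt.1 (hq u hu)
    constructor <;> linarith
  refine ⟨p, q, fun u hu => ?_, fun u hu0 hu1 => ?_, ?_⟩
  · rw [Polynomial.eval_sub]
    linarith [(hpf u hu).1, (hgq u hu).1, hfg u]
  · have hp' : 0 < (1 - u) * u := mul_pos (by linarith) hu0
    have hu : u ∈ Set.Icc (0 : ℝ) 1 := ⟨hu0.le, hu1.le⟩
    obtain ⟨h1, h2⟩ := hs u hu0 hu1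
    exact ⟨(mul_le_mul_of_nonneg_left (hpf u hu).1 hp'.le).trans h1,
      h2.trans (mul_le_mul_of_nonneg_left (hgq u hu).1 hp'.le)⟩
  · calc ∫ u in (0 : ℝ)..1, (q - p).eval u ≤ ∫ u in (0 : ℝ)..1, (g u - f u + ε / 2) := by
          refine intervalIntegral.integral_mono_on zero_le_one
            ((q - p).continuous.intervalIntegrable _ _)
            (Continuous.intervalIntegrable (by fun_prop) _ _) fun u hu => ?_
          rw [Polynomial.eval_sub]
          linarith [(hpf u hu).2, (hgq u hu).2]
      _ = (∫ u in (0 : ℝ)..1, (g u - f u)) + ε / 2 := by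
          rw [intervalIntegral.integral_add (Continuous.intervalIntegrable (by fun_prop) _ _)
            (by simp)]
          simp
      _ ≤ ε := by linarith

section Tauberian

/-- The total weight `a i` of the points `t i ≤ T`. -/
noncomputable def partialWeight {ι : Type} (a t : ι → ℝ) (T : ℝ) : ℝ :=
  ∑' i, if t i ≤ T then a i else 0

lemma IsLogarithmic.summable_ite {ι : Type} {a t : ι → ℝ} (h : IsLogarithmic a t) (T : ℝ) :
    Summable fun i => if t i ≤ T then a i else 0 := by
  refine Summable.of_nonneg_of_le (fun i => ?_) (fun i => ?_)
    ((h.summable 1 one_pos).mul_left (Real.exp T))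
  · split_ifs
    exacts [h.nonneg i, le_rfl]
  · split_ifs with hi
    · have h1 : 1 ≤ Real.exp T * Real.exp (-(1 * t i)) := by
        rw [← Real.exp_add]; exact Real.one_le_exp (by linarith)
      nlinarith [h.nonneg i]
    · have := h.nonneg i
      positivity

lemma exists_eventually_partialWeight {ε : ℝ} (hε : 0 < ε) : ∃ c : ℝ,
    ∀ {ι : Type} {a t : ι → ℝ}, IsLogarithmic a t → ∀ᶠ T in atTop,
      |partialWeight a t T - Real.log T - c| ≤ ε := by
  obtain ⟨p, q, hpq, hs, hint⟩ := exists_polynomial_sandwich (Real.exp_pos (-1))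
    (Real.exp_lt_one_iff.2 (by norm_num : (-1 : ℝ) < 0)) (by positivity : 0 < ε / 3)
  refine ⟨karamataLimit p, fun {ι a t} h => ?_⟩
  have hle : karamataLimit q ≤ karamataLimit p + ε / 3 := by
    have h1 := karamataLimit_add p (q - p)
    rw [add_sub_cancel] at h1
    linarith [karamataLimit_le_integral hpq]
  have inv : Tendsto (fun T : ℝ => T⁻¹) atTop (𝓝[>] 0) := tendsto_inv_atTop_nhdsGT_zero
  have ep := ((h.tendsto_poly p).comp inv).eventually_const_le
    (show karamataLimit p - ε / 3 < karamataLimit p by linarith)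
  have eq := ((h.tendsto_poly q).comp inv).eventually_le_const
    (show karamataLimit q < karamataLimit q + ε / 3 by linarith)
  have eL := (h.tendsto.comp inv).eventually (Metric.closedBall_mem_nhds 0 (by positivity :
    0 < ε / 3))
  filter_upwards [ep, eq, eL, eventually_gt_atTop 0] with T hp hq hL hT
  simp only [Function.comp_apply, Real.dist_eq, sub_zero] at hp hq hL
  have hTi : 0 < T⁻¹ := inv_pos.2 hT
  have hu0 : ∀ i, 0 < Real.exp (-(T⁻¹ * t i)) := fun i => Real.exp_pos _
  have hu1 : ∀ i, Real.exp (-(T⁻¹ * t i)) < 1 := fun i =>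
    Real.exp_lt_one_iff.2 (neg_lt_zero.2 (mul_pos hTi (h.pos i)))
  have key : partialWeight a t T - ∑' i, a i * Real.exp (-(T⁻¹ * t i)) =
      ∑' i, a i * ((if Real.exp (-1) ≤ Real.exp (-(T⁻¹ * t i)) then 1 else 0) -
        Real.exp (-(T⁻¹ * t i))) := by
    rw [partialWeight, ← (h.summable_ite T).tsum_sub (h.summable _ hTi)]
    refine tsum_congr fun i => ?_
    have : (Real.exp (-1) ≤ Real.exp (-(T⁻¹ * t i))) ↔ t i ≤ T := by
      rw [Real.exp_le_exp, neg_le_neg_iff, inv_mul_le_iff₀ hT, mul_one]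
    simp only [this]
    split_ifs <;> ring
  have hsum : Summable fun i => a i * ((if Real.exp (-1) ≤ Real.exp (-(T⁻¹ * t i)) then 1 else 0) -
        Real.exp (-(T⁻¹ * t i))) := by
    refine ((h.summable_ite T).sub (h.summable _ hTi)).congr fun i => ?_
    have : (Real.exp (-1) ≤ Real.exp (-(T⁻¹ * t i))) ↔ t i ≤ T := by
      rw [Real.exp_le_exp, neg_le_neg_iff, inv_mul_le_iff₀ hT, mul_one]
    simp only [this]
    split_ifs <;> ring
  have lo := (h.summable_poly p hTi).tsum_le_tsum (fun i =>
    mul_le_mul_of_nonneg_left (hs _ (hu0 i) (hu1 i)).1 (h.nonneg i)) hsum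
  have hi := hsum.tsum_le_tsum (fun i =>
    mul_le_mul_of_nonneg_left (hs _ (hu0 i) (hu1 i)).2 (h.nonneg i)) (h.summable_poly q hTi)
  rw [← key] at lo hi
  rw [Real.log_inv] at hL
  have := abs_le.1 hL
  rw [abs_le]
  constructor <;> linarith

/-- Karamata's Tauberian theorem, comparing two families of weights with the same logarithmic
Laplace asymptotics. -/
theorem IsLogarithmic.tendsto_partialWeight_sub {ι κ : Type} {a t : ι → ℝ} {a' t' : κ → ℝ}
    (h : IsLogarithmic a t) (h' : IsLogarithmic a' t') :
    Tendsto (fun T => partialWeight a t T - partialWeight a' t' T) atTop (𝓝 0) := by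
  rw [Metric.tendsto_nhds]
  intro ε hε
  obtain ⟨c, hc⟩ := exists_eventually_partialWeight (by positivity : 0 < ε / 3)
  filter_upwards [hc h, hc h'] with T h1 h2
  rw [abs_le] at h1 h2
  rw [Real.dist_eq, sub_zero, abs_lt]
  constructor <;> linarith

end Tauberian

lemma isLogarithmic_nat :
    IsLogarithmic (fun m : ℕ => 1 / ((m : ℝ) + 1)) (fun m : ℕ => (m : ℝ) + 1) := by
  have hsum : ∀ δ : ℝ, 0 < δ → HasSum (fun m : ℕ => 1 / ((m : ℝ) + 1) *
      Real.exp (-(δ * ((m : ℝ) + 1)))) (-Real.log (1 - Real.exp (-δ))) := by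
    intro δ hδ
    have h1 : |Real.exp (-δ)| < 1 := by
      rw [abs_of_pos (Real.exp_pos _)]
      exact Real.exp_lt_one_iff.2 (by linarith)
    refine (Real.hasSum_pow_div_log_of_abs_lt_one h1).congr_fun fun m => ?_
    rw [← Real.exp_nat_mul]
    push_cast
    ring_nf
  refine ⟨fun m => by positivity, fun m => by positivity, fun δ hδ => (hsum δ hδ).summable, ?_⟩
  have hd : HasDerivAt (fun x : ℝ => 1 - Real.exp (-x)) 1 0 := by
    have := ((hasDerivAt_neg (0 : ℝ)).exp).const_sub 1
    simpa using this
  have hslope : Tendsto (fun δ : ℝ => (1 - Real.exp (-δ)) / δ) (𝓝[>] 0) (𝓝 1) := by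
    have := hd.tendsto_slope_zero_right
    refine this.congr fun δ => ?_
    simp [div_eq_inv_mul]
  have hlog := (hslope.log one_ne_zero).neg
  rw [Real.log_one, neg_zero] at hlog
  refine hlog.congr' ?_
  filter_upwards [self_mem_nhdsWithin] with δ (hδ : 0 < δ)
  have h1 : 0 < 1 - Real.exp (-δ) := sub_pos.2 (Real.exp_lt_one_iff.2 (by linarith))
  rw [(hsum δ hδ).tsum_eq, Real.log_div h1.ne' hδ.ne']
  ring

lemma tendsto_partialWeight_nat :
    Tendsto (fun T => partialWeight (fun m : ℕ => 1 / ((m : ℝ) + 1)) (fun m : ℕ => (m : ℝ) + 1) T -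
      Real.log T) atTop (𝓝 Real.eulerMascheroniConstant) := by
  have h1 := Real.tendsto_harmonic_sub_log.comp (tendsto_nat_floor_atTop (α := ℝ))
  have h2 := (tendsto_nat_floor_div_atTop (R := ℝ)).log one_ne_zero
  rw [Real.log_one] at h2
  have h3 := h1.add h2
  rw [add_zero] at h3
  refine h3.congr' ?_
  filter_upwards [eventually_ge_atTop 1] with T hT
  have hf : (0 : ℝ) < ⌊T⌋₊ := by exact_mod_cast Nat.floor_pos.2 hT
  have hw : partialWeight (fun m : ℕ => 1 / ((m : ℝ) + 1)) (fun m : ℕ => (m : ℝ) + 1) T =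
      harmonic ⌊T⌋₊ := by
    have hiff : ∀ m : ℕ, (m : ℝ) + 1 ≤ T ↔ m < ⌊T⌋₊ := by
      intro m
      rw [← Nat.succ_le_iff, Nat.le_floor_iff (by linarith)]
      push_cast; rfl
    rw [partialWeight, tsum_eq_sum (s := Finset.range ⌊T⌋₊)]
    · rw [harmonic]
      push_cast
      refine Finset.sum_congr rfl fun m hm => ?_
      rw [if_pos ((hiff m).2 (Finset.mem_range.1 hm)), one_div]
    · intro m hm
      rw [if_neg]
      rw [hiff]
      simpa using hm
  simp only [Function.comp_apply]
  rw [hw, Real.log_div hf.ne' (by linarith)]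
  ring

lemma le_neg_log_one_sub {v : ℝ} (hv : v < 1) : v ≤ -Real.log (1 - v) := by
  have := Real.log_le_sub_one_of_pos (sub_pos.2 hv)
  linarith

lemma neg_log_one_sub_le {v : ℝ} (hv : v ≤ 1 / 2) :
    -Real.log (1 - v) ≤ v + 2 * v ^ 2 := by
  have h1 : 0 < 1 - v := by linarith
  have h2 := Real.one_sub_inv_le_log_of_pos h1
  have h3 : (1 - v)⁻¹ ≤ 1 + v + 2 * v ^ 2 := by
    rw [inv_le_iff_one_le_mul₀ h1]
    nlinarith [mul_nonneg (sq_nonneg v) (by linarith : 0 ≤ 1 - 2 * v)]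
  linarith

lemma Nat.Primes.one_div_pos (p : Nat.Primes) : 0 < 1 / (p : ℝ) :=
  _root_.one_div_pos.2 (by exact_mod_cast p.2.pos)

lemma Nat.Primes.one_div_le_half (p : Nat.Primes) : 1 / (p : ℝ) ≤ 1 / 2 :=
  one_div_le_one_div_of_le two_pos (by exact_mod_cast p.2.two_le)

lemma summable_primes_inv_sq : Summable fun p : Nat.Primes => (1 / (p : ℝ)) ^ 2 := by
  have := Nat.Primes.summable_rpow.2 (by norm_num : (-2 : ℝ) < -1)
  refine this.congr fun p => ?_
  rw [Real.rpow_neg (Nat.cast_nonneg _), one_div, inv_pow]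
  norm_cast

lemma tendsto_tsum_primes_neg_log :
    Tendsto (fun δ : ℝ => ∑' p : Nat.Primes, -Real.log (1 - (p : ℝ) ^ (-(1 + δ))) + Real.log δ)
      (𝓝[>] 0) (𝓝 0) := by
  have shift : Tendsto (fun δ : ℝ => 1 + δ) (𝓝[>] 0) (𝓝[>] 1) := by
    refine tendsto_nhdsWithin_iff.2 ⟨?_, ?_⟩
    · have : Tendsto (fun δ : ℝ => 1 + δ) (𝓝 0) (𝓝 (1 + 0)) := tendsto_id.const_add 1
      rw [add_zero] at this
      exact this.mono_left nhdsWithin_le_nhds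
    · filter_upwards [self_mem_nhdsWithin] with δ (hδ : 0 < δ)
      exact lt_add_of_pos_right 1 hδ
  have h1 := (tendsto_sub_mul_tsum_nat_rpow.comp shift).log one_ne_zero
  rw [Real.log_one] at h1
  refine h1.congr' ?_
  filter_upwards [self_mem_nhdsWithin] with δ (hδ : 0 < δ)
  have hs : (0 : ℝ) < 1 + δ := by linarith
  let f : ℕ →*₀ ℝ :=
    { toFun := fun n => (n : ℝ) ^ (-(1 + δ))
      map_zero' := by
        rw [Nat.cast_zero]
        exact Real.zero_rpow (neg_ne_zero.2 hs.ne')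
      map_one' := by simp
      map_mul' := fun m n => by
        push_cast
        exact Real.mul_rpow m.cast_nonneg n.cast_nonneg }
  have hf : ∀ n, f n = (n : ℝ) ^ (-(1 + δ)) := fun _ => rfl
  have hfs : Summable fun n : ℕ => (n : ℝ) ^ (-(1 + δ)) :=
    Real.summable_nat_rpow.2 (by linarith)
  have hprod := EulerProduct.eulerProduct_completely_multiplicative_hasProd (f := f)
    (by simpa only [hf] using hfs.norm)
  simp only [hf] at hprod
  have hlt : ∀ p : Nat.Primes, 0 < 1 - (p : ℝ) ^ (-(1 + δ)) := fun p =>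
    sub_pos.2 (Real.rpow_lt_one_of_one_lt_of_neg (by exact_mod_cast p.2.one_lt) (by linarith))
  have hsl : Summable fun p : Nat.Primes => Real.log ((1 - (p : ℝ) ^ (-(1 + δ)))⁻¹) := by
    have h2 : Summable fun p : Nat.Primes => -(p : ℝ) ^ (-(1 + δ)) :=
      (Nat.Primes.summable_rpow.2 (by linarith)).neg
    refine (Real.summable_log_one_add_of_summable h2).neg.congr fun p => ?_
    rw [Real.log_inv, sub_eq_add_neg]
  have he := Real.rexp_tsum_eq_tprod (fun p => inv_pos.2 (hlt p)) hsl
  rw [hprod.tprod_eq] at he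
  have hz : ∑' n : ℕ, 1 / (n : ℝ) ^ (1 + δ) = ∑' n : ℕ, (n : ℝ) ^ (-(1 + δ)) :=
    tsum_congr fun n => by rw [Real.rpow_neg n.cast_nonneg, one_div]
  simp only [Function.comp_apply, add_sub_cancel_left]
  rw [hz, ← he, Real.log_mul hδ.ne' (Real.exp_pos _).ne', Real.log_exp, add_comm]
  congr 1
  exact tsum_congr fun p => Real.log_inv _

lemma isLogarithmic_primes :
    IsLogarithmic (fun p : Nat.Primes => -Real.log (1 - 1 / (p : ℝ)))
      (fun p : Nat.Primes => Real.log p) := by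
  have hp1 : ∀ p : Nat.Primes, (1 : ℝ) < p := fun p => by exact_mod_cast p.2.one_lt
  have hp0 : ∀ p : Nat.Primes, (0 : ℝ) < p := fun p => by linarith [hp1 p]
  have ha0 : ∀ p : Nat.Primes, 1 / (p : ℝ) ≤ -Real.log (1 - 1 / (p : ℝ)) := fun p =>
    le_neg_log_one_sub (by linarith [p.one_div_le_half])
  have ha1 : ∀ p : Nat.Primes, -Real.log (1 - 1 / (p : ℝ)) ≤ 1 / p + 2 * (1 / (p : ℝ)) ^ 2 :=
    fun p => neg_log_one_sub_le p.one_div_le_half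
  have hexp : ∀ (δ : ℝ) (p : Nat.Primes), Real.exp (-(δ * Real.log p)) = (p : ℝ) ^ (-δ) := by
    intro δ p
    rw [Real.rpow_def_of_pos (hp0 p)]
    ring_nf
  have hsplit : ∀ (δ : ℝ) (p : Nat.Primes),
      (p : ℝ) ^ (-(1 + δ)) = 1 / (p : ℝ) * (p : ℝ) ^ (-δ) := by
    intro δ p
    rw [neg_add, Real.rpow_add (hp0 p), Real.rpow_neg_one, one_div]
  have hx1 : ∀ δ : ℝ, 0 < δ → ∀ p : Nat.Primes, (p : ℝ) ^ (-δ) ≤ 1 := fun δ hδ p =>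
    Real.rpow_le_one_of_one_le_of_nonpos (hp1 p).le (by linarith)
  have hx0 : ∀ (δ : ℝ) (p : Nat.Primes), 0 < (p : ℝ) ^ (-δ) := fun δ p =>
    Real.rpow_pos_of_pos (hp0 p) _
  have hsum : ∀ δ : ℝ, 0 < δ → Summable fun p : Nat.Primes =>
      -Real.log (1 - 1 / (p : ℝ)) * Real.exp (-(δ * Real.log p)) := by
    intro δ hδ
    have h2 : Summable fun p : Nat.Primes => (p : ℝ) ^ (-(1 + δ)) :=
      Nat.Primes.summable_rpow.2 (by linarith)
    refine Summable.of_nonneg_of_le (fun p => ?_) (fun p => ?_) (h2.mul_left 2)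
    · exact mul_nonneg (p.one_div_pos.le.trans (ha0 p)) (Real.exp_pos _).le
    · rw [hexp, hsplit, ← mul_assoc]
      refine mul_le_mul_of_nonneg_right ?_ (hx0 δ p).le
      nlinarith [ha1 p, p.one_div_le_half, p.one_div_pos]
  refine ⟨fun p => p.one_div_pos.le.trans (ha0 p), fun p => Real.log_pos (hp1 p), hsum, ?_⟩
  have hdom : Tendsto (fun δ : ℝ => ∑' p : Nat.Primes,
      (-Real.log (1 - 1 / (p : ℝ)) * Real.exp (-(δ * Real.log p)) -
        -Real.log (1 - (p : ℝ) ^ (-(1 + δ))))) (𝓝[>] 0) (𝓝 (∑' _p : Nat.Primes, (0 : ℝ))) := by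
    refine tendsto_tsum_of_dominated_convergence
      (bound := fun p : Nat.Primes => 2 * (1 / (p : ℝ)) ^ 2)
      (summable_primes_inv_sq.mul_left 2) (fun p => ?_) ?_
    · have hx : Tendsto (fun δ : ℝ => (p : ℝ) ^ (-δ)) (𝓝[>] 0) (𝓝 1) := by
        have : Continuous fun δ : ℝ => (p : ℝ) ^ (-δ) :=
          continuous_const.rpow continuous_neg fun _ => Or.inl (hp0 p).ne'
        have := this.tendsto 0
        rw [neg_zero, Real.rpow_zero] at this
        exact this.mono_left nhdsWithin_le_nhds
      have h1 : (1 : ℝ) - 1 / p * 1 ≠ 0 := by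
        have := p.one_div_le_half
        exact ne_of_gt (by linarith)
      have h2 := (hx.const_mul (-Real.log (1 - 1 / (p : ℝ)))).sub
        (((hx.const_mul (1 / (p : ℝ))).const_sub 1).log h1).neg
      simp only [mul_one, sub_self] at h2
      simpa only [hexp, hsplit] using h2
    · filter_upwards [self_mem_nhdsWithin] with δ hδ p
      rw [hexp, hsplit, Real.norm_eq_abs]
      set v := 1 / (p : ℝ)
      set x := (p : ℝ) ^ (-δ)
      have hv0 : 0 < v := p.one_div_pos
      have hv : v ≤ 1 / 2 := p.one_div_le_half
      have x0 : 0 < x := hx0 δ p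
      have x1 : x ≤ 1 := hx1 δ hδ p
      have hvx : v * x ≤ v := mul_le_of_le_one_right hv0.le x1
      have hvx0 : 0 < v * x := mul_pos hv0 x0
      have b1 := le_neg_log_one_sub (v := v * x) (by linarith)
      have b2 := neg_log_one_sub_le (v := v * x) (by linarith)
      have b3 := mul_le_mul_of_nonneg_right (ha0 p) x0.le
      have b4 := mul_le_mul_of_nonneg_right (ha1 p) x0.le
      have b5 : (v * x) ^ 2 ≤ v ^ 2 := by gcongr
      have b6 : v ^ 2 * x ≤ v ^ 2 := mul_le_of_le_one_right (sq_nonneg v) x1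
      rw [abs_le]
      constructor <;> linarith
  rw [tsum_zero] at hdom
  have := hdom.add tendsto_tsum_primes_neg_log
  rw [add_zero] at this
  refine this.congr' ?_
  filter_upwards [self_mem_nhdsWithin] with δ (hδ : 0 < δ)
  have hsl : Summable fun p : Nat.Primes => -Real.log (1 - (p : ℝ) ^ (-(1 + δ))) := by
    have h2 : Summable fun p : Nat.Primes => -(p : ℝ) ^ (-(1 + δ)) :=
      (Nat.Primes.summable_rpow.2 (by linarith)).neg
    refine (Real.summable_log_one_add_of_summable h2).neg.congr fun p => ?_
    rw [sub_eq_add_neg]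
  rw [(hsum δ hδ).tsum_sub hsl]
  ring

/-- The Mertens sum `-∑ log (1 - 1/p)` over the primes `p ≤ x`. -/
noncomputable def mertensSum (x : ℝ) : ℝ :=
  ∑' p : Nat.Primes, if (p : ℝ) ≤ x then -Real.log (1 - 1 / (p : ℝ)) else 0

lemma mertensSum_eq_partialWeight {x : ℝ} (hx : 0 < x) :
    mertensSum x = partialWeight (fun p : Nat.Primes => -Real.log (1 - 1 / (p : ℝ)))
      (fun p : Nat.Primes => Real.log p) (Real.log x) := by
  refine tsum_congr fun p => ?_
  have hp : (0 : ℝ) < p := by exact_mod_cast p.2.pos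
  simp only [Real.log_le_log_iff hp hx]

lemma summable_mertensSum {x : ℝ} (hx : 0 < x) :
    Summable fun p : Nat.Primes => if (p : ℝ) ≤ x then -Real.log (1 - 1 / (p : ℝ)) else 0 := by
  refine (isLogarithmic_primes.summable_ite (Real.log x)).congr fun p => ?_
  have hp : (0 : ℝ) < p := by exact_mod_cast p.2.pos
  simp only [Real.log_le_log_iff hp hx]

/-- Mertens' third theorem. -/
theorem tendsto_mertensSum_sub_log_log :
    Tendsto (fun x => mertensSum x - Real.log (Real.log x)) atTop
      (𝓝 Real.eulerMascheroniConstant) := by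
  have h := (isLogarithmic_primes.tendsto_partialWeight_sub isLogarithmic_nat).add
    tendsto_partialWeight_nat
  rw [zero_add] at h
  refine (h.comp Real.tendsto_log_atTop).congr' ?_
  filter_upwards [eventually_gt_atTop 0] with x hx
  rw [mertensSum_eq_partialWeight hx]
  simp only [Function.comp_apply]
  ring

lemma tendsto_mertensSum_mul_sq {c : ℝ} (hc : 0 < c) :
    Tendsto (fun k : ℕ => mertensSum (c * (k : ℝ) ^ 2) - Real.log (2 * Real.log k)) atTop
      (𝓝 Real.eulerMascheroniConstant) := by
  have hk : Tendsto (fun k : ℕ => (k : ℝ)) atTop atTop := tendsto_natCast_atTop_atTop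
  have hy : Tendsto (fun k : ℕ => c * (k : ℝ) ^ 2) atTop atTop :=
    ((tendsto_pow_atTop two_ne_zero).comp hk).const_mul_atTop hc
  have hl : Tendsto (fun k : ℕ => 2 * Real.log k) atTop atTop :=
    (Real.tendsto_log_atTop.comp hk).const_mul_atTop two_pos
  have hr : Tendsto (fun k : ℕ => Real.log c / (2 * Real.log k) + 1) atTop (𝓝 1) := by
    simpa using (hl.const_div_atTop (Real.log c)).add_const 1
  have hlog := hr.log one_ne_zero
  rw [Real.log_one] at hlog
  have := (tendsto_mertensSum_sub_log_log.comp hy).add hlog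
  rw [add_zero] at this
  refine this.congr' ?_
  filter_upwards [hl.eventually_gt_atTop 0, (Real.tendsto_log_atTop.comp hy).eventually_gt_atTop 0,
    eventually_gt_atTop 0] with k h1 h2 h3
  have hk0 : (0 : ℝ) < k := by exact_mod_cast h3
  simp only [Function.comp_apply] at h2 ⊢
  have e : Real.log c / (2 * Real.log k) + 1 = Real.log (c * (k : ℝ) ^ 2) / (2 * Real.log k) := by
    rw [Real.log_mul hc.ne' (by positivity), Real.log_pow, add_div, Nat.cast_ofNat,
      div_self h1.ne']
  rw [e, Real.log_div h2.ne' h1.ne']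
  ring

lemma tsum_primes_le_of_sum_Ioc_le {f : ℕ → ℝ} {C : ℝ} (hf : ∀ n, 0 ≤ f n)
    (hC : ∀ n, ∑ i ∈ Finset.Ioc 0 n, f i ≤ C) :
    Summable (fun p : Nat.Primes => f p) ∧ ∑' p : Nat.Primes, f p ≤ C := by
  have key : ∀ s : Finset Nat.Primes, ∑ p ∈ s, f p ≤ C := by
    intro s
    set t : Finset ℕ := s.image fun p : Nat.Primes => (p : ℕ) with ht
    have e : ∑ p ∈ s, f p = ∑ n ∈ t, f n :=
      (Finset.sum_image fun p _ q _ h => Nat.Primes.coe_nat_injective h).symm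
    rw [e]
    refine le_trans ?_ (hC (t.sup id))
    refine Finset.sum_le_sum_of_subset_of_nonneg (fun n hn => ?_) fun n _ _ => hf n
    rw [Finset.mem_Ioc]
    refine ⟨?_, Finset.le_sup (f := id) hn⟩
    obtain ⟨p, -, rfl⟩ := Finset.mem_image.1 hn
    exact p.2.pos
  exact ⟨summable_of_sum_le (fun p => hf p) key, Real.tsum_le_of_sum_le (fun p => hf p) key⟩

lemma sum_Ioc_inv_sqrt_le (n : ℕ) : ∑ i ∈ Finset.Ioc 0 n, 1 / √(i : ℝ) ≤ 2 * √(n : ℝ) := by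
  induction n with
  | zero => simp
  | succ n ih =>
    rw [Finset.sum_Ioc_succ_top (Nat.zero_le n)]
    have h1 : 0 < √((n + 1 : ℕ) : ℝ) := Real.sqrt_pos.2 (by positivity)
    have h2 : 0 ≤ √(n : ℝ) := Real.sqrt_nonneg _
    have h3 : √((n + 1 : ℕ) : ℝ) ^ 2 = n + 1 := by
      rw [Real.sq_sqrt (by positivity)]; push_cast; rfl
    have h4 : √(n : ℝ) ^ 2 = n := Real.sq_sqrt (by positivity)
    have h5 : 1 / √((n + 1 : ℕ) : ℝ) ≤ 2 * √((n + 1 : ℕ) : ℝ) - 2 * √(n : ℝ) := by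
      rw [div_le_iff₀ h1]
      nlinarith [sq_nonneg (√((n + 1 : ℕ) : ℝ) - √(n : ℝ))]
    linarith

lemma tsum_primes_inv_sqrt_le {Y : ℝ} (hY : 0 ≤ Y) :
    Summable (fun p : Nat.Primes => if (p : ℝ) ≤ Y then 1 / √(p : ℝ) else 0) ∧
      ∑' p : Nat.Primes, (if (p : ℝ) ≤ Y then 1 / √(p : ℝ) else 0) ≤ 2 * √Y := by
  refine tsum_primes_le_of_sum_Ioc_le (f := fun n => if (n : ℝ) ≤ Y then 1 / √(n : ℝ) else 0)
    (fun n => by split_ifs <;> positivity) fun n => ?_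
  rw [← Finset.sum_filter]
  calc ∑ i ∈ (Finset.Ioc 0 n).filter (fun i : ℕ => (i : ℝ) ≤ Y), 1 / √(i : ℝ)
      ≤ ∑ i ∈ Finset.Ioc 0 ⌊Y⌋₊, 1 / √(i : ℝ) := by
        refine Finset.sum_le_sum_of_subset_of_nonneg (fun i hi => ?_) fun _ _ _ => by positivity
        rw [Finset.mem_filter, Finset.mem_Ioc] at hi
        exact Finset.mem_Ioc.2 ⟨hi.1.1, Nat.le_floor hi.2⟩
    _ ≤ 2 * √(⌊Y⌋₊ : ℝ) := sum_Ioc_inv_sqrt_le _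
    _ ≤ 2 * √Y := by
        gcongr
        exact Nat.floor_le hY

lemma tsum_primes_inv_sq_le {N : ℕ} (hN : N ≠ 0) :
    Summable (fun p : Nat.Primes => if (N : ℝ) < p then 1 / (p : ℝ) ^ 2 else 0) ∧
      ∑' p : Nat.Primes, (if (N : ℝ) < p then 1 / (p : ℝ) ^ 2 else 0) ≤ 1 / (N : ℝ) := by
  refine tsum_primes_le_of_sum_Ioc_le (f := fun n => if (N : ℝ) < n then 1 / (n : ℝ) ^ 2 else 0)
    (fun n => by split_ifs <;> positivity) fun n => ?_
  rw [← Finset.sum_filter]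
  calc ∑ i ∈ (Finset.Ioc 0 n).filter (fun i : ℕ => (N : ℝ) < i), 1 / (i : ℝ) ^ 2
      ≤ ∑ i ∈ Finset.Ioc N (max N n), ((i : ℝ) ^ 2)⁻¹ := by
        simp only [one_div]
        refine Finset.sum_le_sum_of_subset_of_nonneg (fun i hi => ?_) fun _ _ _ => by positivity
        rw [Finset.mem_filter, Finset.mem_Ioc] at hi
        exact Finset.mem_Ioc.2 ⟨by exact_mod_cast hi.2, hi.1.2.trans (le_max_right _ _)⟩
    _ ≤ (N : ℝ)⁻¹ - ((max N n : ℕ) : ℝ)⁻¹ := sum_Ioc_inv_sq_le_sub hN (le_max_left _ _)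
    _ ≤ 1 / N := by
        rw [one_div]
        exact sub_le_self _ (by positivity)

/-- A majorant for the error made at `p` when the local factor of `aCG k` is replaced by
`(1 - 1/p) ^ k²` for `p ≤ 2k²` and by `1` for `p > 2k²`. -/
noncomputable def primeMajorant (k : ℕ) (p : ℝ) : ℝ :=
  if p ≤ 2 * (k : ℝ) ^ 2 then 8 / (k * √p) else 3 * (k : ℝ) ^ 2 / p ^ 2

lemma primeMajorant_nonneg (k : ℕ) (p : ℝ) : 0 ≤ primeMajorant k p := by
  unfold primeMajorant
  split_ifs <;> positivity

lemma primeMajorant_le {k M : ℕ} (hk : 0 < k) (hM : 2 ≤ M) (p : Nat.Primes) :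
    primeMajorant k p ≤
      8 / k * (if (p : ℝ) ≤ 1 / (M : ℝ) ^ 2 * (k : ℝ) ^ 2 then 1 / √(p : ℝ) else 0) +
      12 * ((if (p : ℝ) ≤ M * (k : ℝ) ^ 2 then -Real.log (1 - 1 / (p : ℝ)) else 0) -
        if (p : ℝ) ≤ 1 / (M : ℝ) ^ 2 * (k : ℝ) ^ 2 then -Real.log (1 - 1 / (p : ℝ)) else 0) +
      3 * (k : ℝ) ^ 2 * (if ((M * k ^ 2 : ℕ) : ℝ) < p then 1 / (p : ℝ) ^ 2 else 0) := by
  have hk0 : (0 : ℝ) < k := by exact_mod_cast hk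
  have hM2 : (2 : ℝ) ≤ M := by exact_mod_cast hM
  have hp0 : (0 : ℝ) < p := by exact_mod_cast p.2.pos
  have hs0 : 0 < √(p : ℝ) := Real.sqrt_pos.2 hp0
  have hss : √(p : ℝ) ^ 2 = p := Real.sq_sqrt hp0.le
  have hM1 : 1 / (M : ℝ) ^ 2 ≤ 1 := by
    rw [div_le_one (by positivity)]; nlinarith
  have hkk : (0 : ℝ) < (k : ℝ) ^ 2 := by positivity
  have hcast : ((M * k ^ 2 : ℕ) : ℝ) = M * (k : ℝ) ^ 2 := by push_cast; rfl
  have hlow : 1 / (M : ℝ) ^ 2 * (k : ℝ) ^ 2 ≤ 1 * (k : ℝ) ^ 2 := by gcongr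
  have hhigh : 2 * (k : ℝ) ^ 2 ≤ M * (k : ℝ) ^ 2 := by gcongr
  have ha : 1 / (p : ℝ) ≤ -Real.log (1 - 1 / (p : ℝ)) :=
    le_neg_log_one_sub (by linarith [p.one_div_le_half])
  rw [hcast, primeMajorant]
  by_cases h1 : (p : ℝ) ≤ 1 / (M : ℝ) ^ 2 * (k : ℝ) ^ 2
  · have h2 : (p : ℝ) ≤ 2 * (k : ℝ) ^ 2 := by linarith
    have h3 : (p : ℝ) ≤ M * (k : ℝ) ^ 2 := by linarith
    rw [if_pos h2, if_pos h1, if_pos h3, if_pos h1, if_neg h3.not_gt]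
    refine le_of_eq ?_
    field_simp
    ring
  · rw [if_neg h1, if_neg h1]
    by_cases h3 : (p : ℝ) ≤ M * (k : ℝ) ^ 2
    · rw [if_pos h3, if_neg h3.not_gt]
      suffices h : (if (p : ℝ) ≤ 2 * (k : ℝ) ^ 2 then 8 / (k * √(p : ℝ))
          else 3 * (k : ℝ) ^ 2 / (p : ℝ) ^ 2) ≤ 12 * (1 / (p : ℝ)) by linarith
      split_ifs with h2
      · have h4 : 2 * √(p : ℝ) ≤ 3 * k := by
          refine le_of_sq_le_sq ?_ (by positivity)
          nlinarith
        rw [mul_one_div, div_le_div_iff₀ (by positivity) hp0]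
        nlinarith [mul_le_mul_of_nonneg_right h4 hs0.le]
      · rw [mul_one_div, div_le_div_iff₀ (by positivity) hp0]
        rw [not_le] at h2
        nlinarith [mul_lt_mul_of_pos_right h2 hp0]
    · have h2 : ¬ (p : ℝ) ≤ 2 * (k : ℝ) ^ 2 := fun h => h3 (h.trans hhigh)
      rw [if_neg h2, if_neg h3, if_pos (not_le.1 h3)]
      refine le_of_eq ?_
      ring

lemma summable_primeMajorant_and_tsum_le {k M : ℕ} (hk : 0 < k) (hM : 2 ≤ M) :
    Summable (fun p : Nat.Primes => primeMajorant k p) ∧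
      ∑' p : Nat.Primes, primeMajorant k p ≤ 19 / M +
        12 * (mertensSum (M * (k : ℝ) ^ 2) - mertensSum (1 / (M : ℝ) ^ 2 * (k : ℝ) ^ 2)) := by
  have hk0 : (0 : ℝ) < k := by exact_mod_cast hk
  have hM0 : (0 : ℝ) < M := by exact_mod_cast (by omega : 0 < M)
  obtain ⟨s1, b1⟩ := tsum_primes_inv_sqrt_le
    (by positivity : 0 ≤ 1 / (M : ℝ) ^ 2 * (k : ℝ) ^ 2)
  obtain ⟨s3, b3⟩ := tsum_primes_inv_sq_le (N := M * k ^ 2) (by positivity)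
  have s2 := (summable_mertensSum (by positivity : 0 < (M : ℝ) * (k : ℝ) ^ 2)).sub
    (summable_mertensSum (by positivity : 0 < 1 / (M : ℝ) ^ 2 * (k : ℝ) ^ 2))
  have e2 := (summable_mertensSum (by positivity : 0 < (M : ℝ) * (k : ℝ) ^ 2)).tsum_sub
    (summable_mertensSum (by positivity : 0 < 1 / (M : ℝ) ^ 2 * (k : ℝ) ^ 2))
  have s12 := (s1.mul_left (8 / (k : ℝ))).add (s2.mul_left 12)
  have s := s12.add (s3.mul_left (3 * (k : ℝ) ^ 2))
  have hsum : Summable (fun p : Nat.Primes => primeMajorant k p) :=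
    Summable.of_nonneg_of_le (fun p => primeMajorant_nonneg k p)
      (fun p => primeMajorant_le hk hM p) s
  refine ⟨hsum, ?_⟩
  have hle := hsum.tsum_le_tsum (fun p => primeMajorant_le hk hM p) s
  rw [s12.tsum_add (s3.mul_left _), (s1.mul_left _).tsum_add (s2.mul_left _), tsum_mul_left,
    tsum_mul_left, tsum_mul_left, e2] at hle
  have hsq : √(1 / (M : ℝ) ^ 2 * (k : ℝ) ^ 2) = k / M := by
    rw [Real.sqrt_eq_iff_mul_self_eq (by positivity) (by positivity)]
    field_simp
  rw [hsq] at b1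
  have c1 := mul_le_mul_of_nonneg_left b1 (by positivity : 0 ≤ 8 / (k : ℝ))
  have c3 := mul_le_mul_of_nonneg_left b3 (by positivity : 0 ≤ 3 * (k : ℝ) ^ 2)
  have d1 : 8 / (k : ℝ) * (2 * (k / M)) = 16 / M := by field_simp; norm_num
  have d3 : 3 * (k : ℝ) ^ 2 * (1 / ((M * k ^ 2 : ℕ) : ℝ)) = 3 / M := by
    push_cast; field_simp
  rw [d1] at c1
  rw [d3] at c3
  have d : (19 : ℝ) / M = 16 / M + 3 / M := by ring
  unfold mertensSum
  linarith

lemma tendsto_tsum_primeMajorant :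
    Tendsto (fun k : ℕ => ∑' p : Nat.Primes, primeMajorant k p) atTop (𝓝 0) := by
  rw [Metric.tendsto_nhds]
  intro ε hε
  obtain ⟨n, hn⟩ := exists_nat_gt (38 / ε)
  set M := max 2 n with hMdef
  have hM : 2 ≤ M := le_max_left _ _
  have hM0 : (0 : ℝ) < M := by exact_mod_cast (by omega : 0 < M)
  have hMε : 19 / (M : ℝ) < ε / 2 := by
    have h1 : 38 / ε < M := hn.trans_le (by exact_mod_cast le_max_right 2 n)
    rw [div_lt_iff₀ hε] at h1
    rw [div_lt_iff₀ hM0]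
    linarith
  have h := ((tendsto_mertensSum_mul_sq hM0).sub
    (tendsto_mertensSum_mul_sq (by positivity : 0 < 1 / (M : ℝ) ^ 2))).const_mul 12
  rw [sub_self, mul_zero] at h
  filter_upwards [h.eventually_lt_const (half_pos hε), eventually_gt_atTop 0] with k h1 hk
  have h2 := (summable_primeMajorant_and_tsum_le hk hM).2
  have h3 : 0 ≤ ∑' p : Nat.Primes, primeMajorant k p :=
    tsum_nonneg fun p => primeMajorant_nonneg k p
  rw [Real.dist_eq, sub_zero, abs_of_nonneg h3]
  linarith

lemma dk_succ_prime_pow {p : ℕ} (hp : p.Prime) (k r : ℕ) :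
    dk (k + 1) (p ^ r) = (r + k).choose k := by
  induction k generalizing r with
  | zero => simp [dk, hp.ne_zero]
  | succ k ih =>
    have h : dk (k + 2) = dk (k + 1) * ArithmeticFunction.zeta := pow_succ _ _
    have h2 : dk (k + 2) (p ^ r) = ∑ i ∈ (p ^ r).divisors, dk (k + 1) i := by
      rw [h, ← ArithmeticFunction.natCoe_nat ArithmeticFunction.zeta,
        ArithmeticFunction.coe_mul_zeta_apply]
    rw [h2, Nat.sum_divisors_prime_pow hp, Finset.sum_congr rfl fun i _ => ih i,
      Nat.sum_range_add_choose, add_assoc]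

lemma add_choose_le_succ_pow (k r : ℕ) : (r + k).choose k ≤ (k + 1) ^ r := by
  induction r with
  | zero => simp
  | succ r ih =>
    have h := Nat.add_one_mul_choose_eq (r + k) r
    rw [Nat.choose_symm_add, show (r + k + 1).choose (r + 1) = (r + 1 + k).choose k by
      rw [show r + k + 1 = r + 1 + k by ring, Nat.choose_symm_add]] at h
    have h1 : r + k + 1 ≤ (k + 1) * (r + 1) := by nlinarith [Nat.zero_le (k * r)]
    refine Nat.le_of_mul_le_mul_right ?_ (Nat.succ_pos r)
    calc (r + 1 + k).choose k * (r + 1) = (r + k + 1) * (r + k).choose k := h.symm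
      _ ≤ ((k + 1) * (r + 1)) * (k + 1) ^ r := Nat.mul_le_mul h1 ih
      _ = (k + 1) ^ (r + 1) * (r + 1) := by ring

/-- The local factor `∑_r d_k(p^r)² p^{-r}`. -/
noncomputable def localSum (k p : ℕ) : ℝ := ∑' r : ℕ, (dk k (p ^ r) : ℝ) ^ 2 / (p : ℝ) ^ r

section LocalSum

variable {k p : ℕ}

lemma hasSum_dk_mul_pow (hp : p.Prime) (hk : 0 < k) {w : ℝ} (hw0 : 0 ≤ w) (hw1 : w < 1) :
    HasSum (fun r : ℕ => (dk k (p ^ r) : ℝ) * w ^ r) (1 / (1 - w) ^ k) := by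
  obtain ⟨k, rfl⟩ := Nat.exists_eq_succ_of_ne_zero hk.ne'
  have := hasSum_choose_mul_geometric_of_norm_lt_one k (r := w)
    (by rwa [Real.norm_of_nonneg hw0])
  simpa only [Nat.succ_eq_add_one, dk_succ_prime_pow hp] using this

lemma dk_prime_pow_le (hp : p.Prime) (hk : 0 < k) (r : ℕ) : dk k (p ^ r) ≤ k ^ r := by
  obtain ⟨k, rfl⟩ := Nat.exists_eq_succ_of_ne_zero hk.ne'
  rw [Nat.succ_eq_add_one, dk_succ_prime_pow hp]
  exact add_choose_le_succ_pow k r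

lemma one_div_sqrt_prime_le (hp : p.Prime) : 1 / √(p : ℝ) ≤ 3 / 4 := by
  have h2 : (2 : ℝ) ≤ p := by exact_mod_cast hp.two_le
  have h : 4 / 3 ≤ √(p : ℝ) := Real.le_sqrt_of_sq_le (by linarith)
  rw [div_le_iff₀ (by linarith)]
  linarith

lemma summable_localSum_and_le (hp : p.Prime) (hk : 0 < k) :
    Summable (fun r : ℕ => (dk k (p ^ r) : ℝ) ^ 2 / (p : ℝ) ^ r) ∧
      localSum k p ≤ (1 / (1 - 1 / √(p : ℝ)) ^ k) ^ 2 := by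
  have hw1 := one_div_sqrt_prime_le hp
  set w := 1 / √(p : ℝ) with hw
  have hw0 : 0 ≤ w := by positivity
  have hsum := hasSum_dk_mul_pow hp hk hw0 (by linarith)
  set S := 1 / (1 - w) ^ k
  have hterm : ∀ r : ℕ, (dk k (p ^ r) : ℝ) ^ 2 / (p : ℝ) ^ r = ((dk k (p ^ r) : ℝ) * w ^ r) ^ 2 := by
    intro r
    have : w ^ 2 = 1 / (p : ℝ) := by
      rw [hw, div_pow, Real.sq_sqrt (Nat.cast_nonneg p), one_pow]
    rw [mul_pow, ← pow_mul, mul_comm r 2, pow_mul, this, div_pow, one_pow]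
    ring
  have hn : ∀ r : ℕ, 0 ≤ (dk k (p ^ r) : ℝ) * w ^ r := fun r => by positivity
  have hle : ∀ r : ℕ, (dk k (p ^ r) : ℝ) ^ 2 / (p : ℝ) ^ r ≤ S * ((dk k (p ^ r) : ℝ) * w ^ r) := by
    intro r
    rw [hterm, sq]
    exact mul_le_mul_of_nonneg_right (le_hasSum hsum r fun j _ => hn j) (hn r)
  have hsm : Summable (fun r : ℕ => (dk k (p ^ r) : ℝ) ^ 2 / (p : ℝ) ^ r) :=
    Summable.of_nonneg_of_le (fun r => by positivity) hle (hsum.summable.mul_left S)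
  refine ⟨hsm, ?_⟩
  calc localSum k p ≤ ∑' r : ℕ, S * ((dk k (p ^ r) : ℝ) * w ^ r) :=
        hsm.tsum_le_tsum hle (hsum.summable.mul_left S)
    _ = S ^ 2 := by rw [tsum_mul_left, hsum.tsum_eq, sq]

lemma one_add_le_localSum (hp : p.Prime) (hk : 0 < k) :
    1 + (k : ℝ) ^ 2 / p ≤ localSum k p := by
  have h := (summable_localSum_and_le hp hk).1.sum_le_tsum (Finset.range 2)
    fun r _ => by positivity
  obtain ⟨j, rfl⟩ := Nat.exists_eq_succ_of_ne_zero hk.ne'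
  have h0 := dk_succ_prime_pow hp j 0
  have h1 := dk_succ_prime_pow hp j 1
  rw [zero_add, Nat.choose_self] at h0
  rw [add_comm 1 j, Nat.choose_succ_self_right] at h1
  rw [Finset.sum_range_succ, Finset.sum_range_one, Nat.succ_eq_add_one, h0, h1] at h
  simpa [localSum] using h

lemma localSum_le_of_le (hp : p.Prime) (hk : 0 < k) (hkp : 2 * (k : ℝ) ^ 2 ≤ p) :
    localSum k p ≤ 1 + (k : ℝ) ^ 2 / p + 2 * ((k : ℝ) ^ 2 / p) ^ 2 := by
  have hp0 : (0 : ℝ) < p := by exact_mod_cast hp.pos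
  set x := (k : ℝ) ^ 2 / p with hx
  have hx0 : 0 ≤ x := by positivity
  have hx1 : x ≤ 1 / 2 := by
    rw [hx, div_le_iff₀ hp0]; linarith
  have hg := hasSum_geometric_of_lt_one hx0 (by linarith)
  have hle : ∀ r : ℕ, (dk k (p ^ r) : ℝ) ^ 2 / (p : ℝ) ^ r ≤ x ^ r := by
    intro r
    have : (dk k (p ^ r) : ℝ) ≤ (k : ℝ) ^ r := by exact_mod_cast dk_prime_pow_le hp hk r
    rw [hx, div_pow, ← pow_mul, mul_comm 2 r, pow_mul]
    gcongr
  calc localSum k p ≤ (1 - x)⁻¹ := by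
        rw [← hg.tsum_eq]
        exact (summable_localSum_and_le hp hk).1.tsum_le_tsum hle hg.summable
    _ ≤ 1 + x + 2 * x ^ 2 := by
        rw [inv_le_iff_one_le_mul₀ (by linarith)]
        nlinarith [mul_nonneg (sq_nonneg x) (by linarith : 0 ≤ 1 - 2 * x)]

lemma log_localSum_le_sqrt (hp : p.Prime) (hk : 0 < k) :
    Real.log (localSum k p) ≤ 8 * k * (1 / √(p : ℝ)) := by
  have hw1 := one_div_sqrt_prime_le hp
  have hpos : 0 < localSum k p :=
    lt_of_lt_of_le (by positivity) (one_add_le_localSum hp hk)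
  have h := Real.log_le_log hpos (summable_localSum_and_le hp hk).2
  set w := 1 / √(p : ℝ) with hw
  have hw0 : 0 ≤ w := by positivity
  have h1w : 0 < 1 - w := by linarith
  have h2 : -Real.log (1 - w) ≤ 4 * w := by
    have h3 := Real.one_sub_inv_le_log_of_pos h1w
    have h4 : (1 - w)⁻¹ ≤ 1 + 4 * w := by
      rw [inv_le_iff_one_le_mul₀ h1w]
      nlinarith
    linarith
  rw [Real.log_pow, one_div, Real.log_inv, Real.log_pow] at h
  push_cast at h
  have hk0 : (0 : ℝ) < k := by exact_mod_cast hk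
  nlinarith [mul_le_mul_of_nonneg_left h2 hk0.le]

lemma log_localFactor (hp : p.Prime) (hk : 0 < k) :
    0 < (1 - 1 / (p : ℝ)) ^ (k ^ 2) * localSum k p ∧
      Real.log ((1 - 1 / (p : ℝ)) ^ (k ^ 2) * localSum k p) =
        (k : ℝ) ^ 2 * Real.log (1 - 1 / (p : ℝ)) + Real.log (localSum k p) := by
  have hpos : 0 < localSum k p :=
    lt_of_lt_of_le (by positivity) (one_add_le_localSum hp hk)
  have h1 : 0 < 1 - 1 / (p : ℝ) := by
    have := Nat.Primes.one_div_le_half ⟨p, hp⟩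
    simp only at this
    linarith
  refine ⟨by positivity, ?_⟩
  rw [Real.log_mul (by positivity) hpos.ne', Real.log_pow]
  push_cast
  rfl

lemma abs_log_localFactor_le (hp : p.Prime) (hk : 0 < k) :
    |Real.log ((1 - 1 / (p : ℝ)) ^ (k ^ 2) * localSum k p) / (k : ℝ) ^ 2 +
      (if (p : ℝ) ≤ 2 * (k : ℝ) ^ 2 then -Real.log (1 - 1 / (p : ℝ)) else 0)| ≤
        primeMajorant k p := by
  have hk0 : (0 : ℝ) < k := by exact_mod_cast hk
  have hp0 : (0 : ℝ) < p := by exact_mod_cast hp.pos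
  have hk2 : (0 : ℝ) < (k : ℝ) ^ 2 := by positivity
  have hlow := one_add_le_localSum hp hk
  rw [(log_localFactor hp hk).2, add_div, mul_div_cancel_left₀ _ hk2.ne', primeMajorant]
  split_ifs with h
  · rw [show ∀ x y : ℝ, x + y + -x = y by intros; ring, abs_of_nonneg]
    · rw [div_le_iff₀ hk2]
      refine (log_localSum_le_sqrt hp hk).trans (le_of_eq ?_)
      have : √(p : ℝ) ≠ 0 := (Real.sqrt_pos.2 hp0).ne'
      field_simp
    · refine div_nonneg (Real.log_nonneg (le_trans ?_ hlow)) hk2.le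
      exact le_add_of_nonneg_right (by positivity)
  · have hkp : 2 * (k : ℝ) ^ 2 ≤ p := (not_le.1 h).le
    have hup := localSum_le_of_le hp hk hkp
    have hpos : 0 < localSum k p := lt_of_lt_of_le (by positivity) hlow
    have hv : 1 / (p : ℝ) ≤ 1 / 2 := Nat.Primes.one_div_le_half ⟨p, hp⟩
    set v := 1 / (p : ℝ) with hvdef
    have hv0 : 0 < v := by positivity
    have hxv : (k : ℝ) ^ 2 / p = (k : ℝ) ^ 2 * v := by rw [hvdef]; ring
    rw [hxv] at hlow hup
    set K := (k : ℝ) ^ 2 with hK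
    have hK1 : 1 ≤ K := by
      have : (1 : ℝ) ≤ k := by exact_mod_cast hk
      nlinarith
    have hL1 : Real.log (localSum k p) ≤ K * v + 2 * (K * v) ^ 2 := by
      linarith [Real.log_le_sub_one_of_pos hpos]
    have hL0 : K * v - (K * v) ^ 2 ≤ Real.log (localSum k p) := by
      have hKv : 0 < K * v := by positivity
      have h1 := Real.one_sub_inv_le_log_of_pos (by linarith : 0 < 1 + K * v)
      have h2 := Real.log_le_log (by linarith) hlow
      have h3 : (1 + K * v)⁻¹ ≤ 1 - K * v + (K * v) ^ 2 := by
        rw [inv_le_iff_one_le_mul₀ (by linarith)]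
        nlinarith [pow_pos hKv 3]
      linarith
    have a1 := le_neg_log_one_sub (v := v) (by linarith)
    have a2 := neg_log_one_sub_le (v := v) hv
    have b1 : Real.log (localSum k p) / K ≤ v + 2 * K * v ^ 2 := by
      rw [div_le_iff₀ hk2]; linarith
    have b0 : v - K * v ^ 2 ≤ Real.log (localSum k p) / K := by
      rw [le_div_iff₀ hk2]; linarith
    have e : 3 * K / (p : ℝ) ^ 2 = 3 * (K * v ^ 2) := by rw [hvdef]; field_simp
    have c : v ^ 2 ≤ K * v ^ 2 := le_mul_of_one_le_left (sq_nonneg v) hK1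
    have c0 : 0 ≤ v ^ 2 := sq_nonneg v
    rw [e, abs_le]
    constructor <;> linarith

end LocalSum

lemma abs_log_aCG_add_mertensSum_le {k : ℕ} (hk : 0 < k) :
    |Real.log (aCG k) / (k : ℝ) ^ 2 + mertensSum (2 * (k : ℝ) ^ 2)| ≤
      ∑' p : Nat.Primes, primeMajorant k p := by
  have hk2 : (0 : ℝ) < (k : ℝ) ^ 2 := by positivity
  have hm := (summable_primeMajorant_and_tsum_le hk le_rfl).1
  have hM := summable_mertensSum (by positivity : 0 < 2 * (k : ℝ) ^ 2)
  have hE : ∀ p : Nat.Primes, ‖Real.log ((1 - 1 / (p : ℝ)) ^ (k ^ 2) * localSum k p) / (k : ℝ) ^ 2 +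
      (if (p : ℝ) ≤ 2 * (k : ℝ) ^ 2 then -Real.log (1 - 1 / (p : ℝ)) else 0)‖ ≤
        primeMajorant k p := fun p => abs_log_localFactor_le p.2 hk
  have hEs := Summable.of_norm_bounded hm hE
  have hLs : Summable fun p : Nat.Primes =>
      Real.log ((1 - 1 / (p : ℝ)) ^ (k ^ 2) * localSum k p) / (k : ℝ) ^ 2 :=
    (hEs.sub hM).congr fun p => by ring
  have hlog : Summable fun p : Nat.Primes =>
      Real.log ((1 - 1 / (p : ℝ)) ^ (k ^ 2) * localSum k p) :=
    (hLs.mul_right ((k : ℝ) ^ 2)).congr fun p => div_mul_cancel₀ _ hk2.ne'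
  have hexp := Real.rexp_tsum_eq_tprod
    (f := fun p : Nat.Primes => (1 - 1 / (p : ℝ)) ^ (k ^ 2) * localSum k p)
    (fun p => (log_localFactor p.2 hk).1) hlog
  have ha : Real.log (aCG k) =
      ∑' p : Nat.Primes, Real.log ((1 - 1 / (p : ℝ)) ^ (k ^ 2) * localSum k p) := by
    rw [← Real.log_exp (∑' p : Nat.Primes, _), hexp]
    rfl
  have h := tsum_of_norm_bounded hm.hasSum hE
  rwa [hLs.tsum_add hM, tsum_div_const, ← ha] at h

/-- As `k → ∞`, `log a_k = -k² log(2 e^γ log k) + o(k²)`. -/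
theorem log_aCG_asymptotic :
    Tendsto (fun k : ℕ =>
        Real.log (aCG k) / (k : ℝ) ^ 2 +
          Real.log (2 * Real.exp Real.eulerMascheroniConstant * Real.log k))
      atTop (𝓝 0) := by
  have h1 : Tendsto (fun k : ℕ => Real.log (aCG k) / (k : ℝ) ^ 2 + mertensSum (2 * (k : ℝ) ^ 2))
      atTop (𝓝 0) := by
    refine squeeze_zero_norm' ?_ tendsto_tsum_primeMajorant
    filter_upwards [eventually_gt_atTop 0] with k hk
    exact abs_log_aCG_add_mertensSum_le hk
  have h2 := h1.sub ((tendsto_mertensSum_mul_sq two_pos).sub_const Real.eulerMascheroniConstant)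
  rw [sub_self, sub_zero] at h2
  refine h2.congr' ?_
  filter_upwards [eventually_ge_atTop 2] with k hk
  have hl : 0 < Real.log k := Real.log_pos (by exact_mod_cast hk)
  rw [mul_right_comm, Real.log_mul (by positivity) (Real.exp_pos _).ne', Real.log_exp]
  ring
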